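/- For the Beurling–Selberg minorant F_{[a,b],Δ}(x) = (1/2)(H(Δ(x-a)) - K(Δ(x-a)) + H(Δ(b-x)) - K(Δ(b-x))), where H(z) = (sin^2(πz)/π^2)(Σ_{n∈ℤ} sgn(n)/(z-n)^2 + 2/z) and K(z) = sin^2(πz)/(πz)^2, one has for all real x: |F_{[a,b],Δ}(x)| ≤ 1 and 0 ≤ 1_{[a,b]}(x) - F_{[a,b],Δ}(x) ≤ K(Δ(x-a)) + K(Δ(b-x)). -/

import Mathlib

open Real

/-- The Fejér kernel `K(z) = sin²(πz)/(πz)²`, with `K 0 = 1`. -/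
noncomputable def fejerK (z : ℝ) : ℝ :=
  if z = 0 then 1 else Real.sin (π * z) ^ 2 / (π * z) ^ 2

open Filter Topology

lemma bs_summable (z : ℝ) : Summable (fun n : ℤ => 1 / (z - (n : ℝ)) ^ 2) := by
  have h := (Real.summable_one_div_int_add_rpow (-z) 2).2 (by norm_num)
  refine h.congr fun n => ?_
  rw [Real.rpow_two, sq_abs]
  congr 1
  ring

noncomputable def bsP (z : ℝ) : ℝ := ∑' n : ℕ, 1 / (z - ((n : ℝ) + 1)) ^ 2
noncomputable def bsN (z : ℝ) : ℝ := ∑' n : ℕ, 1 / (z + ((n : ℝ) + 1)) ^ 2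

lemma bs_summableP (z : ℝ) : Summable (fun n : ℕ => 1 / (z - ((n : ℝ) + 1)) ^ 2) := by
  have h := (bs_summable z).comp_injective (i := fun n : ℕ => ((n : ℤ) + 1))
    (fun a b hab => by simpa using hab)
  refine h.congr fun n => ?_
  simp

lemma bs_summableN (z : ℝ) : Summable (fun n : ℕ => 1 / (z + ((n : ℝ) + 1)) ^ 2) := by
  have h := (bs_summable z).comp_injective (i := fun n : ℕ => (-((n : ℤ) + 1)))
    (fun a b hab => by simpa using hab)
  refine h.congr fun n => ?_
  simp only [Function.comp]
  push_cast
  congr 2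
  ring

lemma bs_tsum (z : ℝ) : ∑' n : ℤ, 1 / (z - (n : ℝ)) ^ 2 = bsP z + 1 / z ^ 2 + bsN z := by
  have h1 : HasSum (fun n : ℕ => 1 / (z - ((n : ℝ) + 1)) ^ 2) (bsP z) := (bs_summableP z).hasSum
  have h2 : HasSum (fun n : ℕ => 1 / (z + ((n : ℝ) + 1)) ^ 2) (bsN z) := (bs_summableN z).hasSum
  have := HasSum.of_add_one_of_neg_add_one (f := fun n : ℤ => 1 / (z - (n : ℝ)) ^ 2)
    (m := bsP z) (m' := bsN z) (by convert h1 using 2; simp)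
    (by convert h2 using 2; push_cast; ring)
  rw [this.tsum_eq]
  simp

lemma bs_tsum_sign (z : ℝ) :
    ∑' n : ℤ, Real.sign (n : ℝ) / (z - (n : ℝ)) ^ 2 = bsP z - bsN z := by
  have h1 : HasSum (fun n : ℕ => 1 / (z - ((n : ℝ) + 1)) ^ 2) (bsP z) := (bs_summableP z).hasSum
  have h2 : HasSum (fun n : ℕ => -(1 / (z + ((n : ℝ) + 1)) ^ 2)) (-bsN z) :=
    (bs_summableN z).hasSum.neg
  have := HasSum.of_add_one_of_neg_add_one
    (f := fun n : ℤ => Real.sign (n : ℝ) / (z - (n : ℝ)) ^ 2)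
    (m := bsP z) (m' := - bsN z) (by
      convert h1 using 2 with n
      rw [Real.sign_of_pos (by push_cast; positivity)]; simp)
    (by
      convert h2 using 2 with n
      rw [Real.sign_of_neg (by push_cast; linarith [Nat.cast_nonneg (α := ℝ) n])]
      push_cast; ring)
  rw [this.tsum_eq]
  simp
  ring

lemma bs_csc_aux (z : ℝ) (h0 : 0 < z) (h1 : z < 1) :
    bsP z + bsN z = π ^ 2 / Real.sin (π * z) ^ 2 - 1 / z ^ 2 := by
  obtain ⟨d, hzd, hd1⟩ := exists_between h1
  have hd0 : 0 < d := h0.trans hzd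
  set g : ℕ → ℂ → ℂ := fun n y => 1 / (y - (n + 1)) + 1 / (y + (n + 1)) with hg
  set g' : ℕ → ℂ → ℂ := fun n y => -1 / (y - (n + 1)) ^ 2 + -1 / (y + (n + 1)) ^ 2 with hg'
  have key : ∀ (n : ℕ) (y : ℂ), ‖y‖ < d → (1 - d) * (n + 1) ≤ ‖y - (n + 1)‖ ∧
      (1 - d) * (n + 1) ≤ ‖y + (n + 1)‖ := by
    intro n y hy
    have hn : ‖((n : ℂ) + 1)‖ = n + 1 := by
      have : ((n : ℂ) + 1) = ((n + 1 : ℕ) : ℂ) := by push_cast; ring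
      rw [this, Complex.norm_natCast]; push_cast; ring
    have hn0 : (0 : ℝ) ≤ n := Nat.cast_nonneg n
    constructor
    · have := norm_sub_norm_le ((n : ℂ) + 1) y
      rw [norm_sub_rev] at this
      nlinarith
    · have := norm_sub_norm_le ((n : ℂ) + 1) (-y)
      rw [norm_neg, sub_neg_eq_add, add_comm _ y] at this
      nlinarith
  have hpos : ∀ n : ℕ, 0 < (1 - d) * ((n : ℝ) + 1) := fun n =>
    mul_pos (by linarith) (by positivity)
  have hzC : (z : ℂ) ∈ Complex.integerComplement := by
    rintro ⟨n, hn⟩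
    have : (n : ℝ) = z := by exact_mod_cast hn
    rw [← this] at h0 h1
    have a : (0 : ℤ) < n := by exact_mod_cast h0
    have b : n < (1 : ℤ) := by exact_mod_cast h1
    omega
  have hzb : (z : ℂ) ∈ Metric.ball (0 : ℂ) d := by
    simp [abs_of_pos h0, hzd]
  have hu : Summable (fun n : ℕ => 2 / (1 - d) ^ 2 * (1 / ((n : ℝ) + 1) ^ 2)) := by
    apply Summable.mul_left
    refine (bs_summableN 0).congr fun n => by simp
  have hD := hasDerivAt_tsum_of_isPreconnected (g := g) (g' := g') hu
    (Metric.isOpen_ball (x := (0 : ℂ)) (ε := d))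
    (convex_ball (0 : ℂ) d).isPreconnected
    (by
      intro n y hy
      have hy' : ‖y‖ < d := by simpa using hy
      obtain ⟨k1, k2⟩ := key n y hy'
      have e1 : y - (n + 1) ≠ 0 := norm_pos_iff.1 ((hpos n).trans_le k1)
      have e2 : y + (n + 1) ≠ 0 := norm_pos_iff.1 ((hpos n).trans_le k2)
      have a1 := ((hasDerivAt_id y).sub_const ((n : ℂ) + 1)).inv e1
      have a2 := ((hasDerivAt_id y).add_const ((n : ℂ) + 1)).inv e2
      have := a1.add a2
      simpa [hg, hg', Pi.add_def] using this)
    (by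
      intro n y hy
      have hy' : ‖y‖ < d := by simpa using hy
      obtain ⟨k1, k2⟩ := key n y hy'
      have b1 : ‖-1 / (y - (n + 1)) ^ 2‖ ≤ 1 / ((1 - d) * ((n : ℝ) + 1)) ^ 2 := by
        rw [norm_div, norm_pow, norm_neg, norm_one]
        have := hpos n
        gcongr
      have b2 : ‖-1 / (y + (n + 1)) ^ 2‖ ≤ 1 / ((1 - d) * ((n : ℝ) + 1)) ^ 2 := by
        rw [norm_div, norm_pow, norm_neg, norm_one]
        have := hpos n
        gcongr
      refine (norm_add_le_of_le b1 b2).trans (le_of_eq ?_)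
      rw [mul_pow]
      have : (1 - d) ≠ 0 := by linarith
      field_simp
      ring)
    hzb (summable_cotTerm hzC) hzb
  have hS : Complex.sin (π * z) ≠ 0 := sin_pi_mul_ne_zero hzC
  have hz0 : (z : ℂ) ≠ 0 := by exact_mod_cast h0.ne'
  have hE : HasDerivAt (fun y : ℂ => π * Complex.cot (π * y) - 1 / y)
      (-π ^ 2 / Complex.sin (π * z) ^ 2 + 1 / z ^ 2) (z : ℂ) := by
    have m : HasDerivAt (fun y : ℂ => (π : ℂ) * y) π (z : ℂ) := by
      simpa using (hasDerivAt_id (z : ℂ)).const_mul (π : ℂ)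
    have c := m.ccos
    have s := m.csin
    have q := (c.div s hS).const_mul (π : ℂ)
    have r := (hasDerivAt_id (z : ℂ)).inv hz0
    have t := q.sub r
    have cs := Complex.sin_sq_add_cos_sq ((π : ℂ) * z)
    refine (t.congr_of_eventuallyEq (Eventually.of_forall fun y => ?_)).congr_deriv ?_
    · simp [Complex.cot]
    · simp only [id]
      field_simp
      linear_combination (-(π : ℂ) ^ 2 * z ^ 2) * cs
  have hev : (fun y : ℂ => π * Complex.cot (π * y) - 1 / y) =ᶠ[𝓝 (z : ℂ)]
      (fun y => ∑' n, g n y) := by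
    filter_upwards [Complex.isOpen_compl_range_intCast.mem_nhds hzC] with y hy
    exact cot_series_rep' hy
  have hU := (hD.congr_of_eventuallyEq hev).unique hE
  have hR : ∑' n, g' n z = ((-(bsP z + bsN z) : ℝ) : ℂ) := by
    rw [bsP, bsN, ← (bs_summableP z).tsum_add (bs_summableN z), ← tsum_neg, Complex.ofReal_tsum]
    congr 1
    ext n
    simp only [hg']
    push_cast
    ring
  rw [hR] at hU
  have hU' : (-(bsP z + bsN z)) = -π ^ 2 / Real.sin (π * z) ^ 2 + 1 / z ^ 2 := by
    exact_mod_cast hU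
  rw [neg_div] at hU'
  linarith

lemma bs_csc (z : ℝ) (hz : ∀ n : ℤ, z ≠ (n : ℝ)) :
    bsP z + 1 / z ^ 2 + bsN z = π ^ 2 / Real.sin (π * z) ^ 2 := by
  have h0 : 0 < Int.fract z := by
    rcases (Int.fract_nonneg z).lt_or_eq with h | h
    · exact h
    · exact absurd (by have := Int.self_sub_floor z; linarith) (hz ⌊z⌋)
  have h := bs_csc_aux _ h0 (Int.fract_lt_one z)
  have e1 : Real.sin (π * z) ^ 2 = Real.sin (π * Int.fract z) ^ 2 := by
    have : π * z = π * Int.fract z + (⌊z⌋ : ℝ) * π := by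
      have := Int.self_sub_floor z
      linear_combination π * this
    rw [this, Real.sin_add_int_mul_pi, mul_pow]
    rcases Int.even_or_odd ⌊z⌋ with k | k
    · simp [k.neg_one_zpow]
    · simp [k.neg_one_zpow]
  rw [← bs_tsum, e1]
  have e2 : ∑' n : ℤ, 1 / (z - (n : ℝ)) ^ 2 = ∑' n : ℤ, 1 / (Int.fract z - (n : ℝ)) ^ 2 := by
    rw [← (Equiv.addRight ⌊z⌋).tsum_eq]
    congr 1
    ext n
    simp only [Equiv.coe_addRight]
    push_cast
    congr 2
    have := Int.self_sub_floor z
    linarith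
  rw [e2, bs_tsum]
  linarith

lemma bs_N_le (z : ℝ) (hz : 0 < z) : bsN z ≤ 1 / z := by
  refine Real.tsum_le_of_sum_range_le (fun n => by positivity) fun m => ?_
  have h : ∀ n ∈ Finset.range m, 1 / (z + ((n : ℝ) + 1)) ^ 2 ≤
      (fun k : ℕ => 1 / (z + (k : ℝ))) n - (fun k : ℕ => 1 / (z + (k : ℝ))) (n + 1) := by
    intro n _
    simp only [Nat.cast_add, Nat.cast_one]
    have hy : 0 < z + (n : ℝ) := by positivity
    rw [← add_assoc]
    generalize z + (n : ℝ) = y at hy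
    rw [div_sub_div _ _ (by positivity) (by positivity), div_le_div_iff₀ (by positivity)
      (by positivity)]
    nlinarith
  refine (Finset.sum_le_sum h).trans ?_
  rw [Finset.sum_range_sub']
  have : 0 ≤ 1 / (z + (m : ℝ)) := by positivity
  simp only [Nat.cast_zero, add_zero]
  linarith

lemma bs_step (y : ℝ) (hy : 0 < y) :
    (1 / y + 1 / (2 * y ^ 2)) - (1 / (y + 1) + 1 / (2 * (y + 1) ^ 2)) ≤ 1 / y ^ 2 := by
  have : 1 / y ^ 2 - ((1 / y + 1 / (2 * y ^ 2)) - (1 / (y + 1) + 1 / (2 * (y + 1) ^ 2)))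
      = 1 / (2 * y ^ 2 * (y + 1) ^ 2) := by
    field_simp
    ring
  have h : 0 ≤ 1 / (2 * y ^ 2 * (y + 1) ^ 2) := by positivity
  linarith

lemma bs_le_N (z : ℝ) (hz : 0 < z) : 1 / z + 1 / (2 * z ^ 2) ≤ 1 / z ^ 2 + bsN z := by
  set c : ℕ → ℝ := fun n => 1 / (z + 1 + n) + 1 / (2 * (z + 1 + n) ^ 2) with hc
  have hlim : Tendsto c atTop (𝓝 0) := by
    have h1 : Tendsto (fun n : ℕ => z + 1 + (n : ℝ)) atTop atTop :=
      tendsto_atTop_add_const_left _ _ tendsto_natCast_atTop_atTop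
    have h2 : Tendsto (fun n : ℕ => (z + 1 + (n : ℝ))⁻¹) atTop (𝓝 0) := h1.inv_tendsto_atTop
    have h3 := h2.add ((h2.pow 2).const_mul (1 / 2))
    simp only [ne_eq, OfNat.ofNat_ne_zero, not_false_eq_true, zero_pow, mul_zero, add_zero] at h3
    refine h3.congr fun n => ?_
    simp only [hc]
    field_simp
  have hb : ∀ n, c 0 - c n ≤ bsN z := by
    intro m
    rw [← Finset.sum_range_sub' c m]
    refine (Finset.sum_le_sum fun n _ => ?_).trans
      ((bs_summableN z).sum_le_tsum (Finset.range m) fun n _ => by positivity)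
    have := bs_step (z + 1 + n) (by positivity)
    simp only [hc]
    push_cast
    rw [show z + ((n : ℝ) + 1) = z + 1 + n by ring,
      show z + 1 + ((n : ℝ) + 1) = z + 1 + n + 1 by ring]
    exact this
  have h4 : c 0 - 0 ≤ bsN z := le_of_tendsto' (tendsto_const_nhds.sub hlim) hb
  have h5 := bs_step z hz
  simp only [hc, Nat.cast_zero, add_zero] at h4
  linarith

lemma bs_K_eq (z : ℝ) : fejerK z = Real.sinc (π * z) ^ 2 := by
  unfold fejerK
  by_cases h : z = 0
  · simp [h]
  · rw [if_neg h, Real.sinc_of_ne_zero (mul_ne_zero Real.pi_ne_zero h), div_pow]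

lemma bs_K_nonneg (z : ℝ) : 0 ≤ fejerK z := by rw [bs_K_eq]; positivity

lemma bs_K_le_one (z : ℝ) : fejerK z ≤ 1 := by
  rw [bs_K_eq, sq_le_one_iff_abs_le_one]
  exact Real.abs_sinc_le_one _

lemma bs_K_neg (z : ℝ) : fejerK (-z) = fejerK z := by
  rw [bs_K_eq, bs_K_eq, mul_neg, Real.sinc_neg]

lemma bs_K_cont : Continuous fejerK := by
  rw [show fejerK = fun z => Real.sinc (π * z) ^ 2 from funext bs_K_eq]
  have := Real.continuous_sinc
  fun_prop

lemma bs_K_le (v : ℝ) (hv : 1 / 2 ≤ v) : fejerK v ≤ 1 / 2 := by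
  unfold fejerK
  rw [if_neg (by linarith), div_le_iff₀ (by have := Real.pi_pos; positivity)]
  have h1 := Real.sin_sq_le_one (π * v)
  have h2 : (3 / 2 : ℝ) ≤ π * v := by nlinarith [Real.pi_gt_three]
  nlinarith

lemma bs_nonint (z : ℝ) : ∀ᶠ y in 𝓝[>] z, z < y ∧ ∀ n : ℤ, y ≠ (n : ℝ) := by
  filter_upwards [Ioo_mem_nhdsGT (Int.lt_floor_add_one z)] with y hy
  refine ⟨hy.1, fun n hn => ?_⟩
  rw [hn] at hy
  have h1 : ⌊z⌋ < n := Int.floor_lt.2 hy.1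
  have h2 : n < ⌊z⌋ + 1 := by exact_mod_cast hy.2
  omega

lemma bs_bounds_aux (H : ℝ → ℝ)
    (hH : ∀ z : ℝ, (∀ n : ℤ, z ≠ (n : ℝ)) →
      H z = (Real.sin (π * z) ^ 2 / π ^ 2)
        * ((∑' n : ℤ, Real.sign (n : ℝ) / (z - (n : ℝ)) ^ 2) + 2 / z))
    (z : ℝ) (h0 : 0 < z) (hz : ∀ n : ℤ, z ≠ (n : ℝ)) :
    H z ≤ 1 ∧ 1 - H z ≤ fejerK z := by
  have hs : Real.sin (π * z) ≠ 0 := by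
    intro h
    obtain ⟨n, hn⟩ := Real.sin_eq_zero_iff.1 h
    apply hz n
    have := Real.pi_pos
    nlinarith
  have hp := bs_csc z hz
  have e : 1 - H z = (Real.sin (π * z) ^ 2 / π ^ 2) * (2 * bsN z + 1 / z ^ 2 - 2 / z) := by
    have : (1 : ℝ) = (Real.sin (π * z) ^ 2 / π ^ 2) * (bsP z + 1 / z ^ 2 + bsN z) := by
      rw [hp]
      field_simp [Real.pi_ne_zero]
    rw [hH z hz, bs_tsum_sign]
    linear_combination this
  have hq : 0 ≤ Real.sin (π * z) ^ 2 / π ^ 2 := by positivity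
  have k : fejerK z = (Real.sin (π * z) ^ 2 / π ^ 2) * (1 / z ^ 2) := by
    unfold fejerK
    rw [if_neg h0.ne']
    field_simp
  have b1 := bs_N_le z h0
  have b2 := bs_le_N z h0
  have r1 : 2 / z = 2 * (1 / z) := by ring
  have r2 : 1 / (2 * z ^ 2) = (1 / 2) * (1 / z ^ 2) := by field_simp
  constructor
  · have : 0 ≤ 1 - H z := by
      rw [e]
      apply mul_nonneg hq
      rw [r1]
      rw [r2] at b2
      linarith
    linarith
  · rw [e, k]
    apply mul_le_mul_of_nonneg_left _ hq
    rw [r1]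
    linarith

lemma bs_bounds (H : ℝ → ℝ) (hHcont : Continuous H)
    (hH : ∀ z : ℝ, (∀ n : ℤ, z ≠ (n : ℝ)) →
      H z = (Real.sin (π * z) ^ 2 / π ^ 2)
        * ((∑' n : ℤ, Real.sign (n : ℝ) / (z - (n : ℝ)) ^ 2) + 2 / z))
    (z : ℝ) (h0 : 0 ≤ z) : H z ≤ 1 ∧ 1 - H z ≤ fejerK z := by
  have hev : ∀ᶠ y in 𝓝[>] z, H y ≤ 1 ∧ 1 - H y ≤ fejerK y := by
    filter_upwards [bs_nonint z] with y hy
    exact bs_bounds_aux H hH y (h0.trans_lt hy.1) hy.2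
  have hc : Tendsto H (𝓝[>] z) (𝓝 (H z)) := hHcont.continuousWithinAt
  have hk : Tendsto fejerK (𝓝[>] z) (𝓝 (fejerK z)) := bs_K_cont.continuousWithinAt
  exact ⟨le_of_tendsto hc (hev.mono fun y h => h.1),
    le_of_tendsto_of_tendsto (tendsto_const_nhds.sub hc) hk (hev.mono fun y h => h.2)⟩

lemma bs_odd (H : ℝ → ℝ) (hHcont : Continuous H)
    (hH : ∀ z : ℝ, (∀ n : ℤ, z ≠ (n : ℝ)) →
      H z = (Real.sin (π * z) ^ 2 / π ^ 2)
        * ((∑' n : ℤ, Real.sign (n : ℝ) / (z - (n : ℝ)) ^ 2) + 2 / z))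
    (z : ℝ) : H (-z) = - H z := by
  have hev : ∀ᶠ y in 𝓝[>] z, H (-y) = - H y := by
    filter_upwards [bs_nonint z] with y hy
    have hn : ∀ n : ℤ, -y ≠ (n : ℝ) := fun n h => hy.2 (-n) (by push_cast; linarith)
    rw [hH y hy.2, hH (-y) hn, bs_tsum_sign, bs_tsum_sign]
    have e1 : bsP (-y) = bsN y := by
      unfold bsP bsN
      congr 1; ext n; congr 1; ring
    have e2 : bsN (-y) = bsP y := by
      unfold bsP bsN
      congr 1; ext n; congr 1; ring
    rw [e1, e2, mul_neg, Real.sin_neg, div_neg]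
    ring
  have hc : Tendsto (fun y => - H y) (𝓝[>] z) (𝓝 (- H z)) :=
    (hHcont.neg).continuousWithinAt
  have hk : Tendsto (fun y => H (- y)) (𝓝[>] z) (𝓝 (H (-z))) :=
    (hHcont.comp continuous_neg).continuousWithinAt
  exact tendsto_nhds_unique (hk.congr' hev) hc

lemma bs_small (H : ℝ → ℝ)
    (hH : ∀ z : ℝ, (∀ n : ℤ, z ≠ (n : ℝ)) →
      H z = (Real.sin (π * z) ^ 2 / π ^ 2)
        * ((∑' n : ℤ, Real.sign (n : ℝ) / (z - (n : ℝ)) ^ 2) + 2 / z))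
    (t v : ℝ) (h0 : 0 < t) (htv : t < v) (hv : v < 1 / 2) :
    H t - 2 * t * fejerK t ≤ H v - 2 * v * fejerK v := by
  have hni : ∀ z : ℝ, 0 < z → z < 1 / 2 → ∀ n : ℤ, z ≠ (n : ℝ) := by
    intro z h1 h2 n hn
    rw [hn] at h1 h2
    have a : (0 : ℤ) < n := by exact_mod_cast h1
    have b : n < (1 : ℤ) := by
      have : (n : ℝ) < 1 := by linarith
      exact_mod_cast this
    omega
  have e : ∀ z : ℝ, 0 < z → z < 1 / 2 →
      H z - 2 * z * fejerK z = Real.sin (π * z) ^ 2 / π ^ 2 * (bsP z - bsN z) := by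
    intro z h1 h2
    rw [hH z (hni z h1 h2), bs_tsum_sign]
    unfold fejerK
    rw [if_neg h1.ne']
    field_simp [Real.pi_ne_zero]
    ring
  rw [e t h0 (htv.trans hv), e v (h0.trans htv) hv]
  have hpi := Real.pi_pos
  have s1 : 0 ≤ Real.sin (π * t) := Real.sin_nonneg_of_nonneg_of_le_pi (by positivity) (by nlinarith)
  have s2 : Real.sin (π * t) ≤ Real.sin (π * v) :=
    Real.sin_le_sin_of_le_of_le_pi_div_two (by nlinarith) (by nlinarith) (by nlinarith)
  have p1 : bsP t ≤ bsP v := by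
    refine (bs_summableP t).tsum_le_tsum (fun n => ?_) (bs_summableP v)
    have hn : (0 : ℝ) ≤ n := Nat.cast_nonneg n
    have : 0 < (v - ((n : ℝ) + 1)) ^ 2 := by
      have : v - ((n : ℝ) + 1) < 0 := by linarith
      exact sq_pos_of_neg this
    apply one_div_le_one_div_of_le this
    nlinarith
  have p2 : bsN v ≤ bsN t := by
    refine (bs_summableN v).tsum_le_tsum (fun n => ?_) (bs_summableN t)
    gcongr
  have p3 : bsN t ≤ bsP t := by
    refine (bs_summableN t).tsum_le_tsum (fun n => ?_) (bs_summableP t)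
    have hn : (0 : ℝ) ≤ n := Nat.cast_nonneg n
    have : 0 < (t - ((n : ℝ) + 1)) ^ 2 := by
      have : t - ((n : ℝ) + 1) < 0 := by linarith
      exact sq_pos_of_neg this
    apply one_div_le_one_div_of_le this
    nlinarith
  apply mul_le_mul _ (by linarith) (by linarith) (by positivity)
  gcongr

lemma bs_diff (H : ℝ → ℝ) (hHcont : Continuous H)
    (hH : ∀ z : ℝ, (∀ n : ℤ, z ≠ (n : ℝ)) →
      H z = (Real.sin (π * z) ^ 2 / π ^ 2)
        * ((∑' n : ℤ, Real.sign (n : ℝ) / (z - (n : ℝ)) ^ 2) + 2 / z))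
    (t v : ℝ) (h0 : 0 < t) (htv : t < v) :
    H t - H v ≤ 2 - fejerK v - fejerK t := by
  have k1 := bs_K_le_one t
  have k2 := bs_K_le_one v
  rcases lt_or_ge v (1 / 2) with hv | hv
  · have := bs_small H hH t v h0 htv hv
    have := bs_K_nonneg v
    nlinarith
  · have := (bs_bounds H hHcont hH t h0.le).1
    have := (bs_bounds H hHcont hH v (h0.trans htv).le).2
    have := bs_K_le v hv
    linarith

lemma bs_out (H : ℝ → ℝ) (hHcont : Continuous H)
    (hH : ∀ z : ℝ, (∀ n : ℤ, z ≠ (n : ℝ)) →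
      H z = (Real.sin (π * z) ^ 2 / π ^ 2)
        * ((∑' n : ℤ, Real.sign (n : ℝ) / (z - (n : ℝ)) ^ 2) + 2 / z))
    (t v : ℝ) (h0 : 0 < t) (htv : t < v) :
    ∀ G, G = (1 / 2) * (H (-t) - fejerK (-t) + H v - fejerK v) →
    -1 ≤ G ∧ G ≤ 0 ∧ -G ≤ fejerK (-t) + fejerK v := by
  intro G hG
  rw [hG]
  have h1 := bs_bounds H hHcont hH t h0.le
  have h2 := bs_bounds H hHcont hH v (h0.trans htv).le
  have h3 := bs_diff H hHcont hH t v h0 htv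
  have h4 := bs_K_nonneg t
  have h5 := bs_K_nonneg v
  simp only [bs_K_neg, bs_odd H hHcont hH]
  refine ⟨?_, ?_, ?_⟩ <;> linarith [h1.1, h1.2, h2.1, h2.2]

theorem beurling_selberg_properties
    (H : ℝ → ℝ) (hHcont : Continuous H)
    (hH : ∀ z : ℝ, (∀ n : ℤ, z ≠ (n : ℝ)) →
      H z = (Real.sin (π * z) ^ 2 / π ^ 2)
        * ((∑' n : ℤ, Real.sign (n : ℝ) / (z - (n : ℝ)) ^ 2) + 2 / z))
    (a b Δ : ℝ) (hab : a < b) (hΔ : 0 < Δ)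
    (F : ℝ → ℝ)
    (hF : ∀ x : ℝ, F x = (1 / 2) * (H (Δ * (x - a)) - fejerK (Δ * (x - a))
        + H (Δ * (b - x)) - fejerK (Δ * (b - x)))) :
    ∀ x : ℝ,
      |F x| ≤ 1 ∧
      0 ≤ Set.indicator (Set.Icc a b) (fun _ => (1 : ℝ)) x - F x ∧
      Set.indicator (Set.Icc a b) (fun _ => (1 : ℝ)) x - F x
        ≤ fejerK (Δ * (x - a)) + fejerK (Δ * (b - x)) := by
  intro x
  rw [hF x, abs_le]
  by_cases hx : x ∈ Set.Icc a b
  · rw [Set.indicator_of_mem hx]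
    have hu := bs_bounds H hHcont hH (Δ * (x - a)) (mul_nonneg hΔ.le (by linarith [hx.1]))
    have hv := bs_bounds H hHcont hH (Δ * (b - x)) (mul_nonneg hΔ.le (by linarith [hx.2]))
    have k1 := bs_K_nonneg (Δ * (x - a))
    have k2 := bs_K_nonneg (Δ * (b - x))
    have k3 := bs_K_le_one (Δ * (x - a))
    have k4 := bs_K_le_one (Δ * (b - x))
    obtain ⟨hu1, hu2⟩ := hu
    obtain ⟨hv1, hv2⟩ := hv
    refine ⟨⟨?_, ?_⟩, ?_, ?_⟩ <;> linarith
  · rw [Set.indicator_of_notMem hx]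
    rcases lt_or_ge x a with h | h
    · have := bs_out H hHcont hH (Δ * (a - x)) (Δ * (b - x)) (mul_pos hΔ (by linarith))
        (mul_lt_mul_of_pos_left (by linarith) hΔ) _ rfl
      rw [show -(Δ * (a - x)) = Δ * (x - a) by ring] at this
      obtain ⟨g1, g2, g3⟩ := this
      refine ⟨⟨?_, ?_⟩, ?_, ?_⟩ <;> linarith
    · have hb : b < x := by
        by_contra hb
        exact hx ⟨h, not_lt.1 hb⟩
      have := bs_out H hHcont hH (Δ * (x - b)) (Δ * (x - a)) (mul_pos hΔ (by linarith))
        (mul_lt_mul_of_pos_left (by linarith) hΔ) _ rfl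
      rw [show -(Δ * (x - b)) = Δ * (b - x) by ring] at this
      obtain ⟨g1, g2, g3⟩ := this
      refine ⟨⟨?_, ?_⟩, ?_, ?_⟩ <;> linarith
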